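/- Let S be a symmetric block tridiagonal matrix all of whose diagonal blocks are invertible. If u ≠ 0 is a vector supported on blocks of even index (u = u_o) with Ψr⁻¹ * Pr *ᵥ u = 0, then Φsym⁻¹ * S *ᵥ u = u; that is, (1, u) is an eigenpair of the symmetric stair preconditioned matrix Φsym⁻¹ * S. -/

import Mathlib

open Matrix

namespace StairPrecond

/-- Real matrices indexed as n×n arrays of m×m blocks. -/
abbrev Mat (n m : ℕ) := Matrix (Fin n × Fin m) (Fin n × Fin m) ℝ

/-- Vectors compatible with `Mat n m`. -/
abbrev Vec (n m : ℕ) := Fin n × Fin m → ℝ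

/-- The (i,j)-block of a block matrix. -/
def blockOf {n m : ℕ} (M : Mat n m) (i j : Fin n) : Matrix (Fin m) (Fin m) ℝ :=
  fun a b => M (i, a) (j, b)

/-- A matrix is block tridiagonal if its (i,j)-block vanishes whenever |i - j| > 1. -/
def IsBlockTridiag {n m : ℕ} (M : Mat n m) : Prop :=
  ∀ i j : Fin n, (i.val + 1 < j.val ∨ j.val + 1 < i.val) → blockOf M i j = 0

/-- The block-diagonal part `D` of a matrix: keep only the diagonal blocks. -/
def blockDiagPart {n m : ℕ} (M : Mat n m) : Mat n m :=
  fun p q => if p.1 = q.1 then M p q else 0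

/-- The left stair Ψl: diagonal blocks everywhere, off-diagonal blocks only in
block rows of odd index (0-indexed). -/
def stairL {n m : ℕ} (M : Mat n m) : Mat n m :=
  fun p q =>
    if p.1 = q.1 ∨ (Odd p.1.val ∧ (p.1.val = q.1.val + 1 ∨ q.1.val = p.1.val + 1)) then M p q
    else 0

/-- The right stair Ψr: diagonal blocks everywhere, off-diagonal blocks only in
block rows of even index (0-indexed). -/
def stairR {n m : ℕ} (M : Mat n m) : Mat n m :=
  fun p q =>
    if p.1 = q.1 ∨ (Even p.1.val ∧ (p.1.val = q.1.val + 1 ∨ q.1.val = p.1.val + 1)) then M p q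
    else 0

/-- Pl = Ψl − S. -/
def Pl {n m : ℕ} (S : Mat n m) : Mat n m := stairL S - S

/-- Pr = Ψr − S. -/
def Pr {n m : ℕ} (S : Mat n m) : Mat n m := stairR S - S

/-- The additive stair preconditioner Φadd⁻¹ = (1/2) • (Ψl⁻¹ + Ψr⁻¹). -/
noncomputable def Phiadd {n m : ℕ} (S : Mat n m) : Mat n m :=
  (1 / 2 : ℝ) • ((stairL S)⁻¹ + (stairR S)⁻¹)

/-- The symmetric stair preconditioner Φsym⁻¹ = Ψl⁻¹ + Ψr⁻¹ − D⁻¹. -/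
noncomputable def Phisym {n m : ℕ} (S : Mat n m) : Mat n m :=
  (stairL S)⁻¹ + (stairR S)⁻¹ - (blockDiagPart S)⁻¹

/-- All diagonal blocks are invertible m×m matrices. -/
def DiagBlocksInvertible {n m : ℕ} (M : Mat n m) : Prop :=
  ∀ i : Fin n, IsUnit (blockOf M i i)

/-- v_e : the part of v supported on blocks of odd index (0-indexed). -/
def vE {n m : ℕ} (v : Vec n m) : Vec n m := fun p => if Odd p.1.val then v p else 0

/-- v_o : the part of v supported on blocks of even index (0-indexed). -/
def vO {n m : ℕ} (v : Vec n m) : Vec n m := fun p => if Even p.1.val then v p else 0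

/-- A stair matrix: block tridiagonal, with off-diagonal blocks nonzero only in
block rows of a fixed parity (a left stair has them only in odd-indexed rows,
a right stair only in even-indexed rows, 0-indexed). -/
def IsStairMatrix {n m : ℕ} (Ψ : Mat n m) : Prop :=
  IsBlockTridiag Ψ ∧
    ((∀ i j : Fin n, i ≠ j → Even i.val → blockOf Ψ i j = 0) ∨
     (∀ i j : Fin n, i ≠ j → Odd i.val → blockOf Ψ i j = 0))

theorem mulVec_eq_blockOf_mulVec {n m : ℕ} {M : Mat n m} {v : Vec n m} {i : Fin n} {a : Fin m}
    (h : ∀ q : Fin n × Fin m, q.1 ≠ i → M (i, a) q * v q = 0) :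
    (M *ᵥ v) (i, a) = (blockOf M i i *ᵥ fun b => v (i, b)) a := by
  simp only [mulVec, dotProduct, blockOf, Fintype.sum_prod_type]
  exact Finset.sum_eq_single i (fun j _ hj => Finset.sum_eq_zero fun b _ => h (j, b) hj) (by simp)

/-- A block matrix with invertible diagonal blocks is invertible if its off-diagonal blocks vanish
outside the rows indexed by `T` and the columns indexed by the complement of `T`. -/
theorem isUnit_of_offDiag {n m : ℕ} {M : Mat n m} (T : Fin n → Prop)
    (hdiag : DiagBlocksInvertible M)
    (hoff : ∀ p q : Fin n × Fin m, p.1 ≠ q.1 → ¬(T p.1 ∧ ¬T q.1) → M p q = 0) :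
    IsUnit M := by
  refine mulVec_injective_iff_isUnit.mp fun x y hxy => sub_eq_zero.mp ?_
  have hv : M *ᵥ (x - y) = 0 := by rw [mulVec_sub]; exact sub_eq_zero.mpr hxy
  generalize x - y = v at hv
  have block_eq_zero (i : Fin n)
      (h : ∀ a, ∀ q : Fin n × Fin m, q.1 ≠ i → M (i, a) q * v q = 0) (a : Fin m) :
      v (i, a) = 0 := by
    have hz : blockOf M i i *ᵥ (fun b => v (i, b)) = blockOf M i i *ᵥ 0 := by
      rw [mulVec_zero]
      funext b
      rw [← mulVec_eq_blockOf_mulVec (h b), hv]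
      rfl
    exact congrFun (mulVec_injective_iff_isUnit.mpr (hdiag i) hz) a
  have hcompl (i : Fin n) (hi : ¬T i) (a : Fin m) : v (i, a) = 0 :=
    block_eq_zero i (fun b q hq => by
      rw [hoff (i, b) q hq.symm fun h => hi h.1, zero_mul]) a
  funext ⟨i, a⟩
  refine block_eq_zero i (fun b q hq => ?_) a
  by_cases hT : T q.1
  · rw [hoff (i, b) q hq.symm fun h => h.2 hT, zero_mul]
  · rw [hcompl q.1 hT q.2, mul_zero]

theorem isUnit_stairL {n m : ℕ} {S : Mat n m} (hdiag : DiagBlocksInvertible S) :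
    IsUnit (stairL S) := by
  refine isUnit_of_offDiag (fun i => Odd i.val) (fun i => ?_) fun p q hpq h => ?_
  · have h : blockOf (stairL S) i i = blockOf S i i := by
      ext a b
      simp [blockOf, stairL]
    exact h ▸ hdiag i
  · exact if_neg (by grind)

theorem isUnit_stairR {n m : ℕ} {S : Mat n m} (hdiag : DiagBlocksInvertible S) :
    IsUnit (stairR S) := by
  refine isUnit_of_offDiag (fun i => Even i.val) (fun i => ?_) fun p q hpq h => ?_
  · have h : blockOf (stairR S) i i = blockOf S i i := by
      ext a b
      simp [blockOf, stairR]
    exact h ▸ hdiag i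
  · exact if_neg (by grind)

theorem isUnit_blockDiagPart {n m : ℕ} {S : Mat n m} (hdiag : DiagBlocksInvertible S) :
    IsUnit (blockDiagPart S) := by
  refine isUnit_of_offDiag (fun _ => True) (fun i => ?_) fun p q hpq _ => if_neg hpq
  have h : blockOf (blockDiagPart S) i i = blockOf S i i := by
    ext a b
    simp [blockOf, blockDiagPart]
  exact h ▸ hdiag i

theorem stairL_mulVec_of_even {n m : ℕ} {S : Mat n m} (htri : IsBlockTridiag S) {u : Vec n m}
    (hsupp : ∀ p : Fin n × Fin m, Odd p.1.val → u p = 0) : stairL S *ᵥ u = S *ᵥ u := by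
  funext p
  refine Finset.sum_congr rfl fun q _ => ?_
  by_cases hq : Odd q.1.val
  · simp [hsupp q hq]
  · have hS (h : p.1.val + 1 < q.1.val ∨ q.1.val + 1 < p.1.val) : S p q = 0 :=
      congrFun (congrFun (htri p.1 q.1 h) p.2) q.2
    simp only [stairL]
    split_ifs with h
    · rfl
    · rw [hS (by grind)]

theorem blockDiagPart_mulVec_of_even {n m : ℕ} (S : Mat n m) {u : Vec n m}
    (hsupp : ∀ p : Fin n × Fin m, Odd p.1.val → u p = 0) :
    blockDiagPart S *ᵥ u = stairR S *ᵥ u := by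
  funext p
  refine Finset.sum_congr rfl fun q _ => ?_
  by_cases hq : Odd q.1.val
  · simp [hsupp q hq]
  · have h : (p.1 = q.1 ∨ (Even p.1.val ∧ (p.1.val = q.1.val + 1 ∨ q.1.val = p.1.val + 1))) ↔
        p.1 = q.1 := by grind
    simp only [blockDiagPart, stairR, h]

/-- If u ≠ 0 is supported on blocks of even index and Ψr⁻¹ * Pr *ᵥ u = 0, then
(1, u) is an eigenpair of Φsym⁻¹ * S. -/
theorem sym_eigenpair_one_of_right_kernel {n m : ℕ} (hn : 0 < n) (hm : 0 < m)
    (S : Mat n m) (hsymm : S.IsSymm) (htri : IsBlockTridiag S)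
    (hdiag : DiagBlocksInvertible S)
    (u : Vec n m) (hu : u ≠ 0)
    (hsupp : ∀ p : Fin n × Fin m, Odd p.1.val → u p = 0)
    (hker : ((stairR S)⁻¹ * Pr S) *ᵥ u = 0) :
    (Phisym S * S) *ᵥ u = u := by
  have inv_mulVec {A : Mat n m} (hA : IsUnit A) (h : A *ᵥ u = S *ᵥ u) : A⁻¹ *ᵥ (S *ᵥ u) = u := by
    rw [← h, mulVec_mulVec, nonsing_inv_mul _ ((isUnit_iff_isUnit_det A).mp hA), one_mulVec]
  have hR : stairR S *ᵥ u = S *ᵥ u := by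
    have h := congrArg (stairR S *ᵥ ·) hker
    simp only [mulVec_mulVec, ← Matrix.mul_assoc, mulVec_zero,
      mul_nonsing_inv _ ((isUnit_iff_isUnit_det _).mp (isUnit_stairR hdiag)), Matrix.one_mul] at h
    rwa [Pr, sub_mulVec, sub_eq_zero] at h
  rw [← mulVec_mulVec, Phisym, sub_mulVec, add_mulVec,
    inv_mulVec (isUnit_stairL hdiag) (stairL_mulVec_of_even htri hsupp),
    inv_mulVec (isUnit_stairR hdiag) hR,
    inv_mulVec (isUnit_blockDiagPart hdiag) ((blockDiagPart_mulVec_of_even S hsupp).trans hR),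
    add_sub_cancel_right]

end StairPrecond
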